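/- In the affine Singer model, let t be a divisor of q+1 and d = (q²−1)/t. Then for every line ℓ' ∈ ℒ there is exactly one point orbit O of the subgroup generated by σ^t with |ℓ' ∩ O| = (q+1)/t − 1, and ℓ' meets each of the other t−1 point orbits in exactly (q+1)/t points. -/

import Mathlib

theorem card_filter_range_mod_eq {n t u : ℕ} (h : t ∣ n) (hu : u < t) :
    ((Finset.range n).filter (fun j => j % t = u)).card = n / t := by
  obtain ⟨m, rfl⟩ := h
  have ht : 0 < t := by omega
  rw [Nat.mul_div_cancel_left _ ht]
  have himage : (Finset.range (t * m)).filter (fun j => j % t = u)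
      = (Finset.range m).image (fun k => u + t * k) := by
    ext j
    simp only [Finset.mem_filter, Finset.mem_range, Finset.mem_image]
    constructor
    · rintro ⟨hj, hju⟩
      refine ⟨j / t, Nat.div_lt_of_lt_mul hj, ?_⟩
      rw [← hju]
      exact Nat.mod_add_div j t
    · rintro ⟨k, hk, rfl⟩
      refine ⟨?_, ?_⟩
      · nlinarith [Nat.mul_le_mul_left t (Nat.succ_le_of_lt hk)]
      · rw [Nat.add_mul_mod_self_left, Nat.mod_eq_of_lt hu]
  rw [himage, Finset.card_image_of_injective, Finset.card_range]
  intro a b hab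
  have hab' : t * a = t * b := by simpa using hab
  exact Nat.eq_of_mul_eq_mul_left ht hab'

theorem Subfield.pow_succ_card_mem {F : Type*} [Field F] [Finite F] {q : ℕ} (hq : 2 ≤ q)
    (hcard : Nat.card F = q ^ 2) (K : Subfield F) (hK : Nat.card K = q) (x : F) :
    x ^ (q + 1) ∈ K := by
  have hnorm := FiniteField.algebraMap_norm_eq_pow (K := K) (K' := F) (x := x)
  have hdiv : (q ^ 2 - 1) / (q - 1) = q + 1 := by
    have hfac : q ^ 2 - 1 = (q + 1) * (q - 1) := by
      simpa using Nat.sq_sub_sq q 1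
    rw [hfac, Nat.mul_div_cancel _ (by omega)]
  rw [hcard, hK, hdiv] at hnorm
  rw [← hnorm]
  exact (Algebra.norm K x).2

theorem orderOf_eq_card_sub_one_of_forall_exists_pow {F : Type*} [Field F] [Finite F] {α : F}
    (hα : α ≠ 0) (hprim : ∀ x : F, x ≠ 0 → ∃ i : ℕ, α ^ i = x) :
    orderOf α = Nat.card F - 1 := by
  have hgen : ∀ x : Fˣ, x ∈ Subgroup.zpowers (Units.mk0 α hα) := by
    intro x
    obtain ⟨i, hi⟩ := hprim x x.ne_zero
    exact ⟨i, Units.ext (by simpa using hi)⟩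
  have hord := orderOf_eq_card_of_forall_mem_zpowers hgen
  rw [← orderOf_units, Units.val_mk0, Nat.card_units] at hord
  exact hord

/-- Affine Singer model: `AG(2,q)` is identified with a field `F` of `q²` elements viewed
as a plane over a subfield `Fq` of `q` elements; the point set is `F \\ {0}` with
`P_i = α^i` for a primitive element `α`, and the lines are the affine `Fq`-lines
(cosets `{y | y - x ∈ W}` of `1`-dimensional `Fq`-subspaces `W`) not passing through
`0`.  Let `t ∣ q+1` and `d = (q²−1)/t`, with point orbits `O u = {α^i | i ≡ u (mod t)}`
of `σ^t`.  Then for every line `S` of `ℒ` there is exactly one orbit `O u` with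
`|S ∩ O u| = (q+1)/t − 1`, and `S` meets each of the other `t−1` orbits in exactly
`(q+1)/t` points. -/
theorem stmt17
    (q : ℕ) (hq : ∃ p e : ℕ, p.Prime ∧ 1 ≤ e ∧ q = p ^ e)
    (F : Type) [Field F] [Fintype F] (hcard : Nat.card F = q ^ 2)
    (Fq : Subfield F) (hcardq : Nat.card Fq = q)
    (α : F) (hprim : ∀ x : F, x ≠ 0 → ∃ i : ℕ, α ^ i = x)
    (d t : ℕ) (hd : 0 < d) (hdt : q ^ 2 - 1 = d * t)
    (O : ℕ → Set F)
    (hO : ∀ u : ℕ, O u = {x : F | ∃ i : ℕ, i % t = u % t ∧ x = α ^ i})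
    (htq : t ∣ q + 1)
    :
    ∀ S : Set F,
      (∃ (W : Submodule Fq F) (x : F), Module.finrank Fq W = 1 ∧
        S = {y : F | y - x ∈ W}) →
      (0 : F) ∉ S →
      ∃ u : ℕ, u < t ∧ (S ∩ O u).ncard = (q + 1) / t - 1 ∧
        ∀ u' : ℕ, u' < t → u' ≠ u → (S ∩ O u').ncard = (q + 1) / t := by
  rintro S ⟨W, x, hW, rfl⟩ h0
  classical
  have hq2 : 2 ≤ q := by
    obtain ⟨p, e, hp, he, rfl⟩ := hq
    exact hp.two_le.trans (Nat.le_self_pow (by omega) p)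
  have ht : 0 < t := Nat.pos_of_dvd_of_pos htq (by omega)
  have hα : α ≠ 0 := by
    rintro rfl
    have hle : Nat.card F ≤ ({0, 1} : Finset F).card := by
      rw [Nat.card_eq_fintype_card, ← Finset.card_univ]
      refine Finset.card_le_card fun y _ => ?_
      by_cases hy : y = 0
      · simp [hy]
      · obtain ⟨i, rfl⟩ := hprim y hy
        rcases i with _ | i
        · simp
        · simp
    have := hle.trans Finset.card_le_two
    rw [hcard] at this
    nlinarith
  have hord : orderOf α = d * t := by
    rw [orderOf_eq_card_sub_one_of_forall_exists_pow hα hprim, hcard, hdt]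
  have hlog : ∃ log : F → ℕ, ∀ y, y ≠ 0 → α ^ log y = y := by
    refine ⟨fun y => if h : y = 0 then 0 else (hprim y h).choose, fun y hy => ?_⟩
    simp only [dif_neg hy]
    exact (hprim y hy).choose_spec
  obtain ⟨log, hlog⟩ := hlog
  have hmem : ∀ u < t, ∀ y, y ≠ 0 → (y ∈ O u ↔ log y % (q + 1) % t = u) := by
    intro u hu y hy
    rw [hO, Nat.mod_mod_of_dvd _ htq]
    constructor
    · rintro ⟨i, hi, hyi⟩
      have hpow : Units.mk0 α hα ^ log y = Units.mk0 α hα ^ i :=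
        Units.ext (by simpa [hlog y hy] using hyi)
      have hmod := pow_eq_pow_iff_modEq.1 hpow
      rw [← orderOf_units, Units.val_mk0, hord] at hmod
      rw [Nat.ModEq.of_mul_left d hmod, hi, Nat.mod_eq_of_lt hu]
    · intro h
      exact ⟨log y, by rw [h, Nat.mod_eq_of_lt hu], (hlog y hy).symm⟩
  have hscal_le : ∀ y z, y ≠ 0 → z ≠ 0 → log y % (q + 1) = log z % (q + 1) →
      log z ≤ log y → ∃ k : Fq, y = (k : F) * z := by
    intro y z hy hz h hle
    obtain ⟨m, hm⟩ := (Nat.modEq_iff_dvd' hle).1 h.symm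
    have hexp : log y = m * (q + 1) + log z := by
      rw [mul_comm, ← hm]
      omega
    have hpow : y = (α ^ m) ^ (q + 1) * z := by
      conv_lhs => rw [← hlog y hy, hexp, pow_add, hlog z hz, pow_mul]
    have hmemq := Fq.pow_succ_card_mem hq2 hcard hcardq (α ^ m)
    generalize (α ^ m) ^ (q + 1) = k at hpow hmemq
    exact ⟨⟨k, hmemq⟩, hpow⟩
  have hscal : ∀ y z, y ≠ 0 → z ≠ 0 → log y % (q + 1) = log z % (q + 1) →
      ∃ k : Fq, y = (k : F) * z := by
    intro y z hy hz h
    rcases le_total (log z) (log y) with hle | hle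
    · exact hscal_le y z hy hz h hle
    · obtain ⟨k, hk⟩ := hscal_le z y hz hy h.symm hle
      refine ⟨k⁻¹, ?_⟩
      have hk0 : (k : F) ≠ 0 := by
        intro hk0
        exact hz (by rw [hk, hk0, zero_mul])
      rw [hk]
      push_cast
      rw [inv_mul_cancel_left₀ hk0]
  have hx : x ∉ W := by
    intro hx
    exact h0 (by simpa using hx)
  obtain ⟨w, hw0, -⟩ := finrank_eq_one_iff'.1 hW
  have hwne : (w : F) ≠ 0 := by simpa using hw0
  have hWcard : Nat.card W = q := by
    rw [Module.natCard_eq_pow_finrank (K := Fq), hW, hcardq, pow_one]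
  set S : Set F := {y | y - x ∈ W} with hS
  have hSW : ∀ y ∈ S, y ∉ W := by
    intro y hy hyW
    exact hx (by simpa using W.sub_mem hyW hy)
  have hScard : S.ncard = q := by
    have himage : S = (fun y => y + x) '' (W : Set F) := by
      ext y
      constructor
      · intro hy
        exact ⟨y - x, hy, by simp⟩
      · rintro ⟨z, hz, rfl⟩
        simpa [hS] using hz
    rw [himage, Set.ncard_image_of_injective _ (add_left_injective x), ← hWcard]
    rfl
  have hwS : (w : F) ∉ S := fun h => hSW _ h w.2
  set T : Finset F := insert (w : F) S.toFinset with hT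
  have hTcard : T.card = q + 1 := by
    rw [hT, Finset.card_insert_of_notMem (by simpa using hwS), ← Set.ncard_eq_toFinset_card', hScard]
  have hT0 : ∀ y ∈ T, y ≠ 0 := by
    intro y hy
    rcases Finset.mem_insert.1 hy with rfl | hy
    · exact hwne
    · rintro rfl
      exact h0 (by simpa using hy)
  have hsmul : ∀ (k : Fq) (y : F), (k : F) * y = k • y := fun _ _ => rfl
  have hinj : Set.InjOn (fun y => log y % (q + 1)) (T : Set F) := by
    intro y hy z hz h
    have hy0 := hT0 y hy
    have hz0 := hT0 z hz
    simp only [hT, Finset.coe_insert, Set.coe_toFinset, Set.mem_insert_iff] at hy hz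
    rcases hz with rfl | hz
    · rcases hy with rfl | hy
      · rfl
      · obtain ⟨k, hk⟩ := hscal _ _ hy0 hz0 h
        exact absurd (by rw [hk, hsmul]; exact W.smul_mem k w.2) (hSW y hy)
    · rcases hy with rfl | hy
      · obtain ⟨k, hk⟩ := hscal _ _ hz0 hy0 h.symm
        exact absurd (by rw [hk, hsmul]; exact W.smul_mem k w.2) (hSW z hz)
      · obtain ⟨k, hk⟩ := hscal _ _ hy0 hz0 h
        have hyz : y - z ∈ W := by simpa using W.sub_mem hy hz
        by_cases hk1 : k = 1
        · simpa [hk1] using hk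
        · have hmul : (k - 1) • z ∈ W := by
            have : (k - 1) • z = y - z := by rw [hk, sub_smul, one_smul, hsmul]
            rwa [this]
          exact absurd ((W.smul_mem_iff (sub_ne_zero.2 hk1)).1 hmul) (hSW z hz)
  have himage : T.image (fun y => log y % (q + 1)) = Finset.range (q + 1) := by
    refine Finset.eq_of_subset_of_card_le ?_ ?_
    · intro j hj
      obtain ⟨y, -, rfl⟩ := Finset.mem_image.1 hj
      exact Finset.mem_range.2 (Nat.mod_lt _ (by omega))
    · rw [Finset.card_image_of_injOn hinj, hTcard, Finset.card_range]
  have hcount : ∀ u < t, (T.filter (fun y => log y % (q + 1) % t = u)).card = (q + 1) / t := by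
    intro u hu
    rw [← card_filter_range_mod_eq htq hu, ← himage, Finset.filter_image,
      Finset.card_image_of_injOn]
    exact hinj.mono (Finset.coe_subset.2 (Finset.filter_subset _ _))
  have hinter : ∀ u < t,
      S ∩ O u = ((T.filter (fun y => log y % (q + 1) % t = u)).erase (w : F) : Finset F) := by
    intro u hu
    ext y
    simp only [Set.mem_inter_iff, Finset.coe_erase, Finset.coe_filter, hT, Finset.mem_insert,
      Set.mem_toFinset, Set.mem_sdiff, Set.mem_ofPred_eq, Set.mem_singleton_iff]
    constructor
    · rintro ⟨hy, hyu⟩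
      refine ⟨⟨Or.inr hy, (hmem u hu y ?_).1 hyu⟩, ?_⟩
      · exact fun h => h0 (h ▸ hy)
      · exact fun h => hwS (h ▸ hy)
    · rintro ⟨⟨hy, hyu⟩, hyw⟩
      have hyS := hy.resolve_left hyw
      exact ⟨hyS, (hmem u hu y fun h => h0 (h ▸ hyS)).2 hyu⟩
  refine ⟨log w % (q + 1) % t, Nat.mod_lt _ ht, ?_, ?_⟩
  · rw [hinter _ (Nat.mod_lt _ ht), Set.ncard_coe_finset, Finset.card_erase_of_mem (by simp [hT]),
      hcount _ (Nat.mod_lt _ ht)]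
  · intro u hu hne
    rw [hinter u hu, Set.ncard_coe_finset, Finset.erase_eq_of_notMem, hcount u hu]
    simp only [Finset.mem_filter, not_and]
    exact fun _ h => hne h.symm
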